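/- Suppose additionally that a_m = 0 whenever |m| < c (the partial differential operator has only terms of equal order c). Then there exist complex coefficients v_{k,s}, defined for k ∈ M(p) and represented indices s ∈ j with |ν(s)| = |k| and depending only on a, p, and ν, such that for every vector w ∈ ℂ^{N(p)} with P w = 0 and every k ∈ M(p): w_{ν⁻¹(k)} = Σ_{s ∈ j, |ν(s)| = |k|} v_{k,s} · w_s. -/

import Mathlib

open scoped BigOperators

def Mfin (d t : ℕ) : Finset (Fin d → ℕ) :=
  (Fintype.piFinset fun _ : Fin d => Finset.range (t + 1)).filter fun q => ∑ i, q i ≤ t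

def Nc (d t : ℕ) : ℕ := (Mfin d t).card

structure GradedOrdering (d : ℕ) where
  toEquiv : ℕ+ ≃ (Fin d → ℕ)
  map_one : toEquiv 1 = 0
  graded : ∀ i j : ℕ+, (∑ k, toEquiv i k) < (∑ k, toEquiv j k) → i < j
  compat : ∀ i j k : ℕ+, i < j →
    toEquiv.symm (toEquiv i + toEquiv k) < toEquiv.symm (toEquiv j + toEquiv k)

open Classical in
noncomputable def bcoef {d : ℕ} (a : (Fin d → ℕ) → ℂ) (c : ℕ) (n m : Fin d → ℕ) : ℂ :=
  if n ≤ m ∧ m - n ∈ Mfin d c then a (m - n) else 0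

noncomputable def hIdx {d : ℕ} (a : (Fin d → ℕ) → ℂ) (c p : ℕ) (ν : GradedOrdering d)
    (i : ℕ+) : ℕ+ :=
  (sSup {l : ℕ | 0 < l ∧ l ≤ Nc d p ∧
    bcoef a c (ν.toEquiv i) (ν.toEquiv l.toPNat') ≠ 0}).toPNat'

def barSet {d : ℕ} (a : (Fin d → ℕ) → ℂ) (c p : ℕ) (ν : GradedOrdering d) : Set ℕ+ :=
  {l | ∃ i : ℕ+, (i : ℕ) ≤ Nc d (p - c) ∧ hIdx a c p ν i = l}

open Classical in
noncomputable def Jfin {d : ℕ} (a : (Fin d → ℕ) → ℂ) (c p : ℕ) (ν : GradedOrdering d) :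
    Finset ℕ+ :=
  ((Finset.range (Nc d p)).filter fun l => l.succPNat ∉ barSet a c p ν).image Nat.succPNat

noncomputable def Pbar {d : ℕ} (a : (Fin d → ℕ) → ℂ) (c p : ℕ) (ν : GradedOrdering d) :
    Matrix (Fin (Nc d (p - c))) (Fin (Nc d (p - c))) ℂ :=
  Matrix.of fun i j =>
    bcoef a c (ν.toEquiv i.val.succPNat) (ν.toEquiv (hIdx a c p ν j.val.succPNat))

open Classical in
noncomputable def Mdec {d : ℕ} (a : (Fin d → ℕ) → ℂ) (c p : ℕ) (ν : GradedOrdering d)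
    (i s : ℕ+) : ℂ :=
  if hr : ∃ r : Fin (Nc d (p - c)), hIdx a c p ν r.val.succPNat = i then
    -∑ r₂ : Fin (Nc d (p - c)), (Pbar a c p ν)⁻¹ hr.choose r₂ *
      bcoef a c (ν.toEquiv r₂.val.succPNat) (ν.toEquiv s)
  else if i = s then (1 : ℂ) else 0

noncomputable def pderiv' {d : ℕ} (i : Fin d) (f : (Fin d → ℝ) → ℂ) : (Fin d → ℝ) → ℂ :=
  fun x => fderiv ℝ f x (Pi.single i 1)

noncomputable def mderiv {d : ℕ} (m : Fin d → ℕ) (f : (Fin d → ℝ) → ℂ) :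
    (Fin d → ℝ) → ℂ :=
  (List.finRange d).foldr (fun i g => (pderiv' i)^[m i] g) f

open Classical in
noncomputable def Tmat {d : ℕ} (ν : GradedOrdering d) (hv : Fin d → ℝ) (n i : ℕ+) : ℂ :=
  if ν.toEquiv i ≤ ν.toEquiv n then
    ∏ k, (((hv k : ℝ) : ℂ) ^ ((ν.toEquiv n - ν.toEquiv i) k) /
      (((ν.toEquiv n - ν.toEquiv i) k).factorial : ℂ))
  else 0

noncomputable def alphaVec {d : ℕ} (ν : GradedOrdering d) (y c₁ : Fin d → ℝ) (n : ℕ+) : ℂ :=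
  ∏ k, (((c₁ k - y k : ℝ) : ℂ) ^ (ν.toEquiv n k) / ((ν.toEquiv n k).factorial : ℂ))

theorem mem_Mfin {d t : ℕ} {q : Fin d → ℕ} : q ∈ Mfin d t ↔ ∑ i, q i ≤ t := by
  simp only [Mfin, Finset.mem_filter, Fintype.mem_piFinset, Finset.mem_range,
    and_iff_right_iff_imp]
  intro h i
  have := Finset.single_le_sum (f := q) (fun _ _ => Nat.zero_le _) (Finset.mem_univ i)
  omega

/-- A graded ordering enumerates `M(t)` by the first `N(t)` positive integers. -/
theorem GradedOrdering.le_Nc_iff {d : ℕ} (ν : GradedOrdering d) (t : ℕ) (l : ℕ+) :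
    (l : ℕ) ≤ Nc d t ↔ ∑ i, ν.toEquiv l i ≤ t := by
  constructor
  · intro hl
    by_contra! hlt
    have hsub : (Mfin d t).map ν.toEquiv.symm.toEmbedding ⊆ (Finset.Icc 1 l).erase l := by
      intro x hx
      obtain ⟨q, hq, rfl⟩ := Finset.mem_map.1 hx
      have hq' := mem_Mfin.1 hq
      have := ν.graded (ν.toEquiv.symm q) l (by simpa using lt_of_le_of_lt hq' hlt)
      simpa using this
    have hcard := Finset.card_le_card hsub
    rw [Finset.card_map, Finset.card_erase_of_mem (by simp), PNat.card_Icc] at hcard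
    have := l.pos
    simp only [Nc, PNat.one_coe] at *
    omega
  · intro hl
    have hsub : (Finset.Icc 1 l).map ν.toEquiv.toEmbedding ⊆ Mfin d t := by
      intro x hx
      obtain ⟨j, hj, rfl⟩ := Finset.mem_map.1 hx
      refine mem_Mfin.2 ?_
      by_contra! hlt
      exact absurd (ν.graded l j (lt_of_le_of_lt hl hlt)) (not_lt.2 (Finset.mem_Icc.1 hj).2)
    have hcard := Finset.card_le_card hsub
    rw [Finset.card_map, PNat.card_Icc] at hcard
    simpa [Nc] using hcard

/-- When all terms of the operator have order `c`, nonzero entries of `P` occur only between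
multi-indices whose degrees differ by `c`. -/
theorem sum_eq_of_bcoef_ne_zero {d c : ℕ} {a : (Fin d → ℕ) → ℂ}
    (haeq : ∀ m ∈ Mfin d c, (∑ i, m i) < c → a m = 0) {n m : Fin d → ℕ}
    (h : bcoef a c n m ≠ 0) : ∑ i, m i = ∑ i, n i + c := by
  unfold bcoef at h
  split_ifs at h with hnm
  · have hc : ∑ i, (m - n) i = c :=
      le_antisymm (mem_Mfin.1 hnm.2) (not_lt.1 fun hlt => h (haeq _ hnm.2 hlt))
    rw [← hc, ← Finset.sum_add_distrib]
    exact Finset.sum_congr rfl fun i _ => (Nat.add_sub_of_le (hnm.1 i)).symm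
  · exact absurd rfl h

/-- `h(i)` is the position of the last nonzero entry in row `i` of `P`. -/
theorem hIdx_spec {d p c : ℕ} (hpc : c ≤ p) (ν : GradedOrdering d) {a : (Fin d → ℕ) → ℂ}
    (ha : ∃ m ∈ Mfin d c, (∑ i, m i) = c ∧ a m ≠ 0) {i : ℕ+} (hi : (i : ℕ) ≤ Nc d (p - c)) :
    bcoef a c (ν.toEquiv i) (ν.toEquiv (hIdx a c p ν i)) ≠ 0 ∧
      ∀ l : ℕ+, (l : ℕ) ≤ Nc d p → bcoef a c (ν.toEquiv i) (ν.toEquiv l) ≠ 0 →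
        l ≤ hIdx a c p ν i := by
  set S : Set ℕ := {l : ℕ | 0 < l ∧ l ≤ Nc d p ∧
    bcoef a c (ν.toEquiv i) (ν.toEquiv l.toPNat') ≠ 0}
  have hbdd : BddAbove S := ⟨Nc d p, fun l hl => hl.2.1⟩
  have hmem : ∀ l : ℕ+, (l : ℕ) ≤ Nc d p →
      bcoef a c (ν.toEquiv i) (ν.toEquiv l) ≠ 0 → (l : ℕ) ∈ S :=
    fun l hl hb => ⟨l.pos, hl, by simpa using hb⟩
  have hne : S.Nonempty := by
    obtain ⟨m, hm, hmc, ham⟩ := ha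
    refine ⟨_, hmem (ν.toEquiv.symm (ν.toEquiv i + m)) ?_ ?_⟩
    · rw [ν.le_Nc_iff] at hi ⊢
      simp only [Equiv.apply_symm_apply, Pi.add_apply, Finset.sum_add_distrib]
      omega
    · simpa [bcoef, hm] using ham
  have hsup : sSup S ∈ S := Nat.sSup_mem hne hbdd
  refine ⟨hsup.2.2, fun l hl hb => ?_⟩
  have hle := le_csSup hbdd (hmem l hl hb)
  rw [← PNat.coe_le_coe]
  change (l : ℕ) ≤ ((sSup S).toPNat' : ℕ)
  rwa [Nat.toPNat'_coe, if_pos hsup.1]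

theorem mem_Jfin {d p c : ℕ} {ν : GradedOrdering d} {a : (Fin d → ℕ) → ℂ} {l : ℕ+} :
    l ∈ Jfin a c p ν ↔ (l : ℕ) ≤ Nc d p ∧ l ∉ barSet a c p ν := by
  simp only [Jfin, Finset.mem_image, Finset.mem_filter, Finset.mem_range]
  constructor
  · rintro ⟨n, ⟨hn, hb⟩, rfl⟩
    exact ⟨by simpa using hn, hb⟩
  · rintro ⟨hl, hb⟩
    refine ⟨l.natPred, ⟨?_, by simpa using hb⟩, by simp⟩
    have := l.natPred_add_one
    omega

/-- Elimination along the order: each component of a vector in the kernel of `P` is a fixed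
linear combination of the represented components of the same degree. -/
theorem exists_coeff_of_le_Nc {d p c : ℕ} (hpc : c ≤ p)
    (ν : GradedOrdering d) (a : (Fin d → ℕ) → ℂ)
    (ha : ∃ m ∈ Mfin d c, (∑ i, m i) = c ∧ a m ≠ 0)
    (haeq : ∀ m ∈ Mfin d c, (∑ i, m i) < c → a m = 0) (l : ℕ+) (hl : (l : ℕ) ≤ Nc d p) :
    ∃ u : ℕ+ → ℂ, ∀ w : ℕ+ → ℂ,
      (∀ i : ℕ+, (i : ℕ) ≤ Nc d (p - c) →
        ∑ n ∈ Finset.range (Nc d p),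
          bcoef a c (ν.toEquiv i) (ν.toEquiv n.succPNat) * w n.succPNat = 0) →
      w l = ∑ s ∈ (Jfin a c p ν).filter
        (fun s => (∑ i, ν.toEquiv s i) = ∑ i, ν.toEquiv l i), u s * w s := by
  induction l using PNat.strongInductionOn with
  | _ l ih =>
    by_cases hbar : l ∈ barSet a c p ν
    · obtain ⟨i, hi, hil⟩ := hbar
      obtain ⟨hne, hmax⟩ := hIdx_spec hpc ν ha hi
      rw [hil] at hne hmax
      have hterm : ∀ n : ℕ, ∃ u : ℕ+ → ℂ, n ∈ (Finset.range (Nc d p)).erase l.natPred →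
          ∀ w : ℕ+ → ℂ,
          (∀ i : ℕ+, (i : ℕ) ≤ Nc d (p - c) →
            ∑ n ∈ Finset.range (Nc d p),
              bcoef a c (ν.toEquiv i) (ν.toEquiv n.succPNat) * w n.succPNat = 0) →
          bcoef a c (ν.toEquiv i) (ν.toEquiv n.succPNat) * w n.succPNat =
            ∑ s ∈ (Jfin a c p ν).filter
              (fun s => (∑ i, ν.toEquiv s i) = ∑ i, ν.toEquiv l i), u s * w s := by
        intro n
        by_cases hb : bcoef a c (ν.toEquiv i) (ν.toEquiv n.succPNat) = 0
        · exact ⟨0, fun _ w _ => by simp [hb]⟩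
        by_cases hn : n ∈ (Finset.range (Nc d p)).erase l.natPred
        · have hnN : (n.succPNat : ℕ) ≤ Nc d p := by
            simpa using (Finset.mem_range.1 (Finset.mem_of_mem_erase hn))
          have hlt : n.succPNat < l := by
            refine lt_of_le_of_ne (hmax _ hnN hb) ?_
            rintro rfl
            simp at hn
          obtain ⟨u, hu⟩ := ih _ hlt hnN
          refine ⟨fun s => bcoef a c (ν.toEquiv i) (ν.toEquiv n.succPNat) * u s,
            fun _ w hw => ?_⟩
          rw [hu w hw, Finset.mul_sum, sum_eq_of_bcoef_ne_zero haeq hb,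
            sum_eq_of_bcoef_ne_zero haeq hne]
          exact Finset.sum_congr rfl fun s _ => (mul_assoc _ _ _).symm
        · exact ⟨0, fun h => absurd h hn⟩
      choose u hu using hterm
      refine ⟨fun s => -(bcoef a c (ν.toEquiv i) (ν.toEquiv l))⁻¹ *
        ∑ n ∈ (Finset.range (Nc d p)).erase l.natPred, u n s, fun w hw => ?_⟩
      have hmem : l.natPred ∈ Finset.range (Nc d p) := by
        have := l.natPred_add_one
        rw [Finset.mem_range]
        omega
      have hrow := hw i hi
      rw [← Finset.add_sum_erase _ _ hmem, PNat.succPNat_natPred,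
        Finset.sum_congr rfl (fun n hn => hu n hn w hw), Finset.sum_comm] at hrow
      simp only [mul_assoc, Finset.sum_mul, ← Finset.mul_sum]
      rw [← mul_right_inj' hne, eq_neg_of_add_eq_zero_left hrow]
      field_simp
    · refine ⟨fun s => if s = l then 1 else 0, fun w _ => ?_⟩
      simp [mem_Jfin, hl, hbar]

/-- If additionally `a_m = 0` whenever `|m| < c` (the operator has only
terms of equal order `c`), then there exist complex coefficients `v_{k,s}` (for `k ∈ M(p)`
and represented indices `s ∈ j` with `|ν(s)| = |k|`), depending only on `a`, `p` and `ν`,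
such that every vector `w ∈ ℂ^{N(p)}` with `P w = 0` satisfies
`w_{ν⁻¹(k)} = ∑_{s ∈ j, |ν(s)| = |k|} v_{k,s} w_s` for every `k ∈ M(p)`. -/
theorem deriv_equal_order {d p c : ℕ} (hd : 1 ≤ d) (hc : 1 ≤ c) (hpc : c ≤ p)
    (ν : GradedOrdering d) (a : (Fin d → ℕ) → ℂ)
    (ha : ∃ m ∈ Mfin d c, (∑ i, m i) = c ∧ a m ≠ 0)
    (haeq : ∀ m ∈ Mfin d c, (∑ i, m i) < c → a m = 0) :
    ∃ v : (Fin d → ℕ) → ℕ+ → ℂ,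
      ∀ w : ℕ+ → ℂ,
        (∀ i : ℕ+, (i : ℕ) ≤ Nc d (p - c) →
          ∑ l ∈ Finset.range (Nc d p),
            bcoef a c (ν.toEquiv i) (ν.toEquiv l.succPNat) * w l.succPNat = 0) →
        ∀ k ∈ Mfin d p,
          w (ν.toEquiv.symm k) =
            ∑ s ∈ (Jfin a c p ν).filter (fun s => (∑ i, ν.toEquiv s i) = ∑ i, k i),
              v k s * w s := by
  have hcoeff : ∀ k : Fin d → ℕ, ∃ u : ℕ+ → ℂ, k ∈ Mfin d p → ∀ w : ℕ+ → ℂ,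
      (∀ i : ℕ+, (i : ℕ) ≤ Nc d (p - c) →
        ∑ l ∈ Finset.range (Nc d p),
          bcoef a c (ν.toEquiv i) (ν.toEquiv l.succPNat) * w l.succPNat = 0) →
      w (ν.toEquiv.symm k) =
        ∑ s ∈ (Jfin a c p ν).filter (fun s => (∑ i, ν.toEquiv s i) = ∑ i, k i), u s * w s := by
    intro k
    by_cases hk : k ∈ Mfin d p
    · obtain ⟨u, hu⟩ := exists_coeff_of_le_Nc hpc ν a ha haeq (ν.toEquiv.symm k)
        ((ν.le_Nc_iff _ _).2 (by simpa using mem_Mfin.1 hk))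
      exact ⟨u, fun _ w hw => by simpa using hu w hw⟩
    · exact ⟨0, fun h => absurd h hk⟩
  choose v hv using hcoeff
  exact ⟨v, fun w hw k hk => hv k hk w hw⟩
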